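/- Uniform eidostate thermodynamics: there exist an entropy function 𝕊 and a set 𝒬 of components of content defined on the set 𝒰 of uniform eidostates such that: (a) 𝕊(E + F) = 𝕊(E) + 𝕊(F) for all E, F ∈ 𝒰; (b) Q(E + F) = Q(E) + Q(F) for all E, F ∈ 𝒰 and every Q ∈ 𝒬; (c) for all E, F ∈ 𝒰, E → F if and only if 𝕊(E) ≤ 𝕊(F) and Q(E) = Q(F) for every Q ∈ 𝒬; (d) 𝕊(m) = 0 for every mechanical state m. -/

import Mathlib

structure EidoSys where
  State : Type
  [decEq : DecidableEq State]
  Eido : Set (Finset State)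
  pair : State → State → State
  Sim : Finset State → Finset State → Prop
  Arrow : Finset State → Finset State → Prop
  pair_inj : ∀ a b a' b', pair a b = pair a' b' → a = a' ∧ b = b'
  eido_nonempty : ∀ A ∈ Eido, A.Nonempty
  singleton_mem : ∀ a : State, ({a} : Finset State) ∈ Eido
  comb_mem : ∀ A B : Finset State, Finset.image₂ pair A B ∈ Eido ↔ A ∈ Eido ∧ B ∈ Eido
  subset_mem : ∀ A B : Finset State, A ∈ Eido → B ⊆ A → B.Nonempty → B ∈ Eido
  sim_refl : ∀ A : Finset State, Sim A A
  sim_symm : ∀ A B : Finset State, Sim A B → Sim B A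
  sim_trans : ∀ A B C : Finset State, Sim A B → Sim B C → Sim A C
  sim_comm : ∀ A B : Finset State, Sim (Finset.image₂ pair A B) (Finset.image₂ pair B A)
  sim_assoc : ∀ A B C : Finset State,
    Sim (Finset.image₂ pair (Finset.image₂ pair A B) C) (Finset.image₂ pair A (Finset.image₂ pair B C))
  sim_congr : ∀ A B C : Finset State, Sim A B → Sim (Finset.image₂ pair A C) (Finset.image₂ pair B C)
  arrow_of_sim : ∀ A B : Finset State, A ∈ Eido → B ∈ Eido → Sim A B → Arrow A B
  arrow_trans : ∀ A B C : Finset State, Arrow A B → Arrow B C → Arrow A C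
  arrow_comb : ∀ A B C : Finset State, Arrow A B → Arrow (Finset.image₂ pair A C) (Finset.image₂ pair B C)
  arrow_cancel : ∀ (A B : Finset State) (s : State),
    Arrow (Finset.image₂ pair A {s}) (Finset.image₂ pair B {s}) → Arrow A B
  arrow_nsubset : ∀ A B : Finset State, A ∈ Eido → B ∈ Eido → B ⊂ A → ¬ Arrow A B
  arrow_subset_single : ∀ (A A' : Finset State) (b : State),
    A ∈ Eido → A' ⊆ A → A'.Nonempty → Arrow A {b} → Arrow A' {b}
  arrow_union : ∀ A₁ A₂ B₁ B₂ : Finset State,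
    A₁ ∈ Eido → A₂ ∈ Eido → B₁ ∈ Eido → B₂ ∈ Eido →
    Disjoint A₁ A₂ → Disjoint B₁ B₂ →
    (∀ a ∈ A₁ ∪ A₂, ∀ b ∈ A₁ ∪ A₂, Arrow {a} {b} ∨ Arrow {b} {a}) →
    (∀ a ∈ B₁ ∪ B₂, ∀ b ∈ B₁ ∪ B₂, Arrow {a} {b} ∨ Arrow {b} {a}) →
    Arrow A₁ B₁ → Arrow A₂ B₂ → Arrow (A₁ ∪ A₂) (B₁ ∪ B₂)

attribute [instance] EidoSys.decEq

namespace EidoSys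

variable (S : EidoSys)

/-- Combination of eidostates: the Cartesian product, realized via the pairing map. -/
def comb (A B : Finset S.State) : Finset S.State := Finset.image₂ S.pair A B

/-- The process (A,B) is possible: A ⇌ B. -/
def Pos (A B : Finset S.State) : Prop := S.Arrow A B ∨ S.Arrow B A

/-- A ↔ B. -/
def Rev (A B : Finset S.State) : Prop := S.Arrow A B ∧ S.Arrow B A

/-- Uniform eidostate. -/
def Uniform (A : Finset S.State) : Prop := A ∈ S.Eido ∧ ∀ a ∈ A, ∀ b ∈ A, S.Pos {a} {b}

/-- Record state: a ↔ a + r for some state a. -/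
def IsRecord (r : S.State) : Prop := ∃ a : S.State, S.Rev {a} (S.comb {a} {r})

/-- Information state: an eidostate all of whose elements are record states. -/
def IsInfo (I : Finset S.State) : Prop := I ∈ S.Eido ∧ ∀ r ∈ I, S.IsRecord r

/-- Bit state: an information state with exactly two elements. -/
def IsBit (I : Finset S.State) : Prop := S.IsInfo I ∧ I.card = 2

/-- Information axiom: there exist a bit state and a possible bit process. -/
def InfoAxiom : Prop := ∃ (r : S.State) (I : Finset S.State), S.IsRecord r ∧ S.IsBit I ∧ S.Pos {r} I

/-- Demon axiom. -/
def DemonAxiom : Prop := ∀ a b : S.State, ∀ J : Finset S.State, S.IsInfo J →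
    S.Arrow {a} (S.comb {b} J) →
    (∃ I : Finset S.State, S.IsInfo I ∧ S.Arrow {b} (S.comb {a} I)) ∧
    (∀ I : Finset S.State, S.IsInfo I → S.Arrow {a} (S.comb {b} I) ∨ S.Arrow (S.comb {b} I) {a})

/-- `copies A n` is the combination of `n+1` copies of `A` (so `copies A 0 = A`). -/
def copies (A : Finset S.State) : ℕ → Finset S.State
  | 0 => A
  | n + 1 => S.comb A (copies A n)

/-- Stability axiom: if nA → nB + J for arbitrarily large n, then A → B. -/
def StabilityAxiom : Prop := ∀ A B J : Finset S.State, A ∈ S.Eido → B ∈ S.Eido → S.IsInfo J →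
    (∀ N : ℕ, ∃ n ≥ N, S.Arrow (S.copies A n) (S.comb (S.copies B n) J)) → S.Arrow A B

/-- State-equivalence axiom. -/
def StateEquivAxiom : Prop := ∀ E : Finset S.State, S.Uniform E →
    ∃ e x y : S.State, S.Arrow {x} {y} ∧ S.Rev (S.comb E {x}) (S.comb {e} {y})

/-- `addCopies A B k` is A + k·B (k copies of B appended to A). -/
def addCopies (A B : Finset S.State) : ℕ → Finset S.State
  | 0 => A
  | k + 1 => S.comb (addCopies A B k) B

/-- A designated set of mechanical states. -/
def MechSet (M : Set S.State) : Prop :=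
  (∀ l ∈ M, ∀ m ∈ M, S.pair l m ∈ M) ∧
  (∀ l ∈ M, ∀ m ∈ M, S.Arrow {l} {m} → S.Arrow {m} {l})

/-- Component of content on uniform eidostates. -/
def IsCoCU (Q : Finset S.State → ℝ) : Prop :=
  (∀ E F : Finset S.State, S.Uniform E → S.Uniform F → Q (S.comb E F) = Q E + Q F) ∧
  (∀ E F : Finset S.State, S.Uniform E → S.Uniform F → S.Pos E F → Q E = Q F)

/-- Entropy function on the uniform eidostates (relative to mechanical states M). -/
def IsEntropyU (M : Set S.State) (Ent : Finset S.State → ℝ) : Prop :=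
  (∀ E F : Finset S.State, S.Uniform E → S.Uniform F → Ent (S.comb E F) = Ent E + Ent F) ∧
  (∀ E F : Finset S.State, S.Uniform E → S.Uniform F → S.Pos E F → (S.Arrow E F ↔ Ent E ≤ Ent F)) ∧
  (∀ m ∈ M, Ent {m} = 0) ∧
  (∀ I : Finset S.State, S.IsInfo I → Ent I = Real.logb 2 (I.card))

end EidoSys

/-- An ordered cancellative commutative monoid, presented by a preorder, embeds into a partially
ordered abelian group of differences. -/
theorem exists_ordered_difference_group {α : Type} [Preorder α] (add : α → α → α) (o : α)
    (add_comm_le : ∀ a b, add a b ≤ add b a)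
    (add_assoc_le : ∀ a b c, add (add a b) c ≤ add a (add b c))
    (add_mono : ∀ a b c, a ≤ b → add a c ≤ add b c)
    (add_cancel : ∀ a b c, add a c ≤ add b c → a ≤ b)
    (add_zero_le : ∀ a, add a o ≤ a) (le_add_zero : ∀ a, a ≤ add a o) :
    ∃ (G : Type) (_ : AddCommGroup G) (_ : PartialOrder G) (_ : IsOrderedAddMonoid G) (φ : α → G),
      (∀ a b, φ (add a b) = φ a + φ b) ∧ (∀ a b, φ a ≤ φ b ↔ a ≤ b) ∧
      ∀ g, ∃ a b, g = φ a - φ b := by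
  let M := Antisymmetrization α (· ≤ ·)
  let π : α → M := toAntisymmetrization (· ≤ ·)
  have π_le (a b : α) : π a ≤ π b ↔ a ≤ b := toAntisymmetrization_le_toAntisymmetrization_iff
  have π_surj : Function.Surjective π := Quotient.mk_surjective
  have π_eq (a b : α) (h : a ≤ b) (h' : b ≤ a) : π a = π b :=
    le_antisymm ((π_le a b).2 h) ((π_le b a).2 h')
  have comm (a b : α) : π (add a b) = π (add b a) := π_eq _ _ (add_comm_le a b) (add_comm_le b a)
  have mono (a b c d : α) (h : a ≤ b) (h' : c ≤ d) : add a c ≤ add b d :=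
    (add_mono _ _ _ h).trans <| (add_comm_le _ _).trans <|
      (add_mono _ _ _ h').trans (add_comm_le _ _)
  let mAdd : M → M → M := Quotient.map₂ add fun a b h c d h' =>
    ⟨mono _ _ _ _ h.1 h'.1, mono _ _ _ _ h.2 h'.2⟩
  have mAdd_comm (x y : M) : mAdd x y = mAdd y x := by
    obtain ⟨a, rfl⟩ := π_surj x
    obtain ⟨b, rfl⟩ := π_surj y
    exact comm a b
  have mAdd_zero (x : M) : mAdd x (π o) = x := by
    obtain ⟨a, rfl⟩ := π_surj x
    exact π_eq _ _ (add_zero_le a) (le_add_zero a)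
  let : Zero M := ⟨π o⟩
  let : Add M := ⟨mAdd⟩
  let : AddCommMonoid M :=
    { add_assoc := fun x y z => by
        obtain ⟨a, rfl⟩ := π_surj x
        obtain ⟨b, rfl⟩ := π_surj y
        obtain ⟨c, rfl⟩ := π_surj z
        refine π_eq _ _ (add_assoc_le a b c) ?_
        calc add a (add b c) ≤ add (add b c) a := add_comm_le _ _
          _ ≤ add b (add c a) := add_assoc_le _ _ _
          _ ≤ add (add c a) b := add_comm_le _ _
          _ ≤ add c (add a b) := add_assoc_le _ _ _
          _ ≤ add (add a b) c := add_comm_le _ _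
      zero_add := fun x => (mAdd_comm _ _).trans (mAdd_zero x)
      add_zero := mAdd_zero
      add_comm := mAdd_comm
      nsmul := nsmulRec }
  have π_add (a b : α) : π (add a b) = π a + π b := rfl
  have le_right (a b : M) (h : a ≤ b) (c : M) : a + c ≤ b + c := by
    obtain ⟨a, rfl⟩ := π_surj a
    obtain ⟨b, rfl⟩ := π_surj b
    obtain ⟨c, rfl⟩ := π_surj c
    rw [← π_add, ← π_add, π_le]
    exact add_mono _ _ _ ((π_le _ _).1 h)
  have of_le_right (c a b : M) (h : a + c ≤ b + c) : a ≤ b := by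
    obtain ⟨a, rfl⟩ := π_surj a
    obtain ⟨b, rfl⟩ := π_surj b
    obtain ⟨c, rfl⟩ := π_surj c
    rw [← π_add, ← π_add, π_le] at h
    exact (π_le _ _).2 (add_cancel _ _ _ h)
  have : IsOrderedCancelAddMonoid M :=
    { add_le_add_left := le_right
      le_of_add_le_add_left := fun c a b h => by
        rw [add_comm c a, add_comm c b] at h
        exact of_le_right c a b h }
  refine ⟨Algebra.GrothendieckAddGroup M, inferInstance, inferInstance, inferInstance,
    fun a => AddLocalization.mk (π a) 0, fun a b => ?_, fun a b => ?_, fun g => ?_⟩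
  · simp only [π_add, AddLocalization.mk_add, add_zero]
  · rw [AddLocalization.mk_le_mk]
    simp [π_le]
  · induction g using AddLocalization.ind with
    | H p =>
      obtain ⟨x, y, hy⟩ := p
      obtain ⟨a, rfl⟩ := π_surj x
      obtain ⟨b, rfl⟩ := π_surj y
      refine ⟨a, b, ?_⟩
      rw [Algebra.GrothendieckAddGroup.mk_sub_mk]
      simp

/-- Additive maps into `ℝ` extend along injections of abelian groups. -/
theorem exists_real_extension {A B : Type} [AddCommGroup A] [AddCommGroup B] (f : A →+ B)
    (hf : Function.Injective f) (g : A →+ ℝ) : ∃ h : B →+ ℝ, ∀ a, h (f a) = g a := by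
  obtain ⟨h, hh⟩ := Module.Baer.extension_property_addMonoidHom (Module.Baer.of_divisible ℝ) f hf g
  exact ⟨h, fun a => DFunLike.congr_fun hh a⟩

/-- Real-valued additive maps vanishing on a subgroup `H` with torsion-free quotient detect
membership in `H`. -/
theorem mem_of_forall_real_hom_eq_zero {G : Type} [AddCommGroup G] (H : AddSubgroup G)
    (htors : ∀ (n : ℕ) (x : G), n ≠ 0 → n • x ∈ H → x ∈ H) (x : G)
    (hx : ∀ q : G →+ ℝ, (∀ h ∈ H, q h = 0) → q x = 0) : x ∈ H := by
  by_contra hxH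
  let m : ℤ →+ G ⧸ H := (zmultiplesHom (G ⧸ H)) (x : G ⧸ H)
  have m_apply (k : ℤ) : m k = ((k • x : G) : G ⧸ H) := rfl
  have hm : Function.Injective m := by
    rw [injective_iff_map_eq_zero]
    intro k hk
    rw [m_apply, QuotientAddGroup.eq_zero_iff] at hk
    by_contra hk0
    refine hxH (htors k.natAbs x (Int.natAbs_ne_zero.2 hk0) ?_)
    rw [← natCast_zsmul]
    rcases Int.natAbs_eq k with h | h
    · rwa [← h]
    · rw [h, neg_smul] at hk
      exact neg_mem_iff.1 hk
  obtain ⟨q, hq⟩ := exists_real_extension m hm (Int.castAddHom ℝ)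
  have h1 := hx (q.comp (QuotientAddGroup.mk' H)) fun h hh => by
    have : QuotientAddGroup.mk' H h = 0 := (QuotientAddGroup.eq_zero_iff h).2 hh
    rw [AddMonoidHom.comp_apply, this, map_zero]
  have h2 := hq 1
  rw [m_apply, one_smul] at h2
  have : (1 : ℝ) = 0 := by
    rw [← h1, AddMonoidHom.comp_apply]
    exact (by simpa using h2.symm)
  exact one_ne_zero this

/-- If the elements comparable to `0` form an Archimedean subgroup `H`, then there is a real-valued
additive map, vanishing on a given complement of `H`, which reflects the order on `H`. -/
theorem exists_real_hom_order_iff {G : Type} [AddCommGroup G] [PartialOrder G]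
    [IsOrderedAddMonoid G] (H N : AddSubgroup G) (hH : ∀ x, x ∈ H ↔ 0 ≤ x ∨ x ≤ 0)
    (harch : ∀ x y : G, x ∈ H → 0 ≤ y → (∀ n : ℕ, n • x ≤ y) → x ≤ 0)
    (hN : ∀ x ∈ N, x ∈ H → x = 0) :
    ∃ s : G →+ ℝ, (∀ x ∈ N, s x = 0) ∧ ∀ x ∈ H, (0 ≤ x ↔ 0 ≤ s x) := by
  classical
  let : LinearOrder H :=
    { (inferInstance : PartialOrder H) with
      le_total := fun x y => by
        rcases (hH _).1 (sub_mem y.2 x.2) with h | h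
        · exact Or.inl (sub_nonneg.1 h)
        · exact Or.inr (sub_nonpos.1 h)
      toDecidableLE := Classical.decRel _ }
  have : IsOrderedAddMonoid H := AddSubgroup.toIsOrderedAddMonoid H
  have : Archimedean H := ⟨fun y x hx => by
    by_contra! hcon
    rcases le_total 0 y with hy | hy
    · exact hx.not_ge (harch x y x.2 hy fun n => (hcon n).le)
    · have := hcon 0
      rw [zero_smul] at this
      exact this.not_ge hy⟩
  obtain ⟨f, hf⟩ := Archimedean.exists_orderAddMonoidHom_real_injective H
  let j : H →+ G ⧸ N := (QuotientAddGroup.mk' N).comp H.subtype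
  have hj : Function.Injective j := by
    rw [injective_iff_map_eq_zero]
    intro x hx
    exact Subtype.ext (hN x ((QuotientAddGroup.eq_zero_iff _).1 hx) x.2)
  obtain ⟨s, hs⟩ := exists_real_extension j hj (f : H →+ ℝ)
  refine ⟨s.comp (QuotientAddGroup.mk' N), fun x hx => ?_, fun x hx => ?_⟩
  · have : QuotientAddGroup.mk' N x = 0 := (QuotientAddGroup.eq_zero_iff x).2 hx
    rw [AddMonoidHom.comp_apply, this, map_zero]
  · have hsx : s.comp (QuotientAddGroup.mk' N) x = f ⟨x, hx⟩ := hs ⟨x, hx⟩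
    have hmono : StrictMono f := f.monotone'.strictMono_of_injective hf
    rw [hsx, ← map_zero f, hmono.le_iff_le]
    rfl

namespace EidoSys

variable {S : EidoSys}

theorem comb_singleton (a b : S.State) : S.comb {a} {b} = {S.pair a b} :=
  Finset.image₂_singleton

theorem arrow_refl {A : Finset S.State} (hA : A ∈ S.Eido) : S.Arrow A A :=
  S.arrow_of_sim A A hA hA (S.sim_refl A)

theorem comb_mem_eido {A B : Finset S.State} (hA : A ∈ S.Eido) (hB : B ∈ S.Eido) :
    S.comb A B ∈ S.Eido :=
  (S.comb_mem A B).2 ⟨hA, hB⟩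

theorem arrow_comm {A B : Finset S.State} (hA : A ∈ S.Eido) (hB : B ∈ S.Eido) :
    S.Arrow (S.comb A B) (S.comb B A) :=
  S.arrow_of_sim _ _ (comb_mem_eido hA hB) (comb_mem_eido hB hA) (S.sim_comm A B)

theorem arrow_assoc {A B C : Finset S.State} (hA : A ∈ S.Eido) (hB : B ∈ S.Eido)
    (hC : C ∈ S.Eido) : S.Arrow (S.comb (S.comb A B) C) (S.comb A (S.comb B C)) :=
  S.arrow_of_sim _ _ (comb_mem_eido (comb_mem_eido hA hB) hC)
    (comb_mem_eido hA (comb_mem_eido hB hC)) (S.sim_assoc A B C)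

theorem arrow_assoc_symm {A B C : Finset S.State} (hA : A ∈ S.Eido) (hB : B ∈ S.Eido)
    (hC : C ∈ S.Eido) : S.Arrow (S.comb A (S.comb B C)) (S.comb (S.comb A B) C) :=
  S.arrow_of_sim _ _ (comb_mem_eido hA (comb_mem_eido hB hC))
    (comb_mem_eido (comb_mem_eido hA hB) hC) (S.sim_symm _ _ (S.sim_assoc A B C))

theorem arrow_comb_left {A B C : Finset S.State} (hA : A ∈ S.Eido) (hB : B ∈ S.Eido)
    (hC : C ∈ S.Eido) (h : S.Arrow A B) : S.Arrow (S.comb C A) (S.comb C B) :=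
  S.arrow_trans _ _ _ (arrow_comm hC hA) <|
    S.arrow_trans _ _ _ (S.arrow_comb A B C h) (arrow_comm hB hC)

theorem arrow_right_comm {A B C : Finset S.State} (hA : A ∈ S.Eido) (hB : B ∈ S.Eido)
    (hC : C ∈ S.Eido) : S.Arrow (S.comb (S.comb A B) C) (S.comb (S.comb A C) B) :=
  S.arrow_trans _ _ _ (arrow_assoc hA hB hC) <|
    S.arrow_trans _ _ _
      (arrow_comb_left (comb_mem_eido hB hC) (comb_mem_eido hC hB) hA (arrow_comm hB hC))
      (arrow_assoc_symm hA hC hB)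

theorem arrow_comb_comb_comm {A B C D : Finset S.State} (hA : A ∈ S.Eido) (hB : B ∈ S.Eido)
    (hC : C ∈ S.Eido) (hD : D ∈ S.Eido) :
    S.Arrow (S.comb (S.comb A B) (S.comb C D)) (S.comb (S.comb A C) (S.comb B D)) :=
  S.arrow_trans _ _ _ (arrow_assoc_symm (comb_mem_eido hA hB) hC hD) <|
    S.arrow_trans _ _ _ (S.arrow_comb _ _ D (arrow_right_comm hA hB hC))
      (arrow_assoc (comb_mem_eido hA hC) hB hD)

/-- Any eidostate absorbs and emits record states. -/
theorem IsRecord.rev_comb {r : S.State} (hr : S.IsRecord r) {A : Finset S.State}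
    (hA : A ∈ S.Eido) : S.Rev A (S.comb A {r}) := by
  obtain ⟨a, h, h'⟩ := hr
  have ha := S.singleton_mem a
  have hr' := S.singleton_mem r
  have har := comb_mem_eido ha hr'
  constructor
  · apply S.arrow_cancel _ _ a
    exact S.arrow_trans _ _ _ (arrow_comb_left ha har hA h) <|
      S.arrow_trans _ _ _ (arrow_assoc_symm hA ha hr') (arrow_right_comm hA ha hr')
  · apply S.arrow_cancel _ _ a
    exact S.arrow_trans _ _ _ (arrow_right_comm hA hr' ha) <|
      S.arrow_trans _ _ _ (arrow_assoc hA ha hr') (arrow_comb_left har ha hA h')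

theorem IsRecord.pos {r s : S.State} (hr : S.IsRecord r) (hs : S.IsRecord s) :
    S.Pos {r} {s} :=
  Or.inl <| S.arrow_trans _ _ _ (hs.rev_comb (S.singleton_mem r)).1 <|
    S.arrow_trans _ _ _ (arrow_comm (S.singleton_mem r) (S.singleton_mem s))
      (hr.rev_comb (S.singleton_mem s)).2

theorem IsRecord.pair {r s : S.State} (hr : S.IsRecord r) (hs : S.IsRecord s) :
    S.IsRecord (S.pair r s) := by
  obtain ⟨a, h, h'⟩ := hr
  have ha := S.singleton_mem a
  have hr' := S.singleton_mem r
  have hs' := S.singleton_mem s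
  have hars := hs.rev_comb (comb_mem_eido ha hr')
  refine ⟨a, ?_, ?_⟩
  · rw [← comb_singleton]
    exact S.arrow_trans _ _ _ h (S.arrow_trans _ _ _ hars.1 (arrow_assoc ha hr' hs'))
  · rw [← comb_singleton]
    exact S.arrow_trans _ _ _ (arrow_assoc_symm ha hr' hs') (S.arrow_trans _ _ _ hars.2 h')

theorem IsRecord.isInfo {r : S.State} (hr : S.IsRecord r) : S.IsInfo {r} :=
  ⟨S.singleton_mem r, fun s hs => by rwa [Finset.mem_singleton.1 hs]⟩

theorem IsInfo.uniform {I : Finset S.State} (hI : S.IsInfo I) : S.Uniform I :=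
  ⟨hI.1, fun a ha b hb => (hI.2 a ha).pos (hI.2 b hb)⟩

theorem IsInfo.comb {I J : Finset S.State} (hI : S.IsInfo I) (hJ : S.IsInfo J) :
    S.IsInfo (S.comb I J) := by
  refine ⟨comb_mem_eido hI.1 hJ.1, fun t ht => ?_⟩
  obtain ⟨r, hr, s, hs, rfl⟩ := Finset.mem_image₂.1 ht
  exact (hI.2 r hr).pair (hJ.2 s hs)

theorem Pos.exists_info (hdemon : S.DemonAxiom) {r : S.State} (hr : S.IsRecord r)
    {a b : S.State} (h : S.Pos {a} {b}) : ∃ I, S.IsInfo I ∧ S.Arrow {a} (S.comb {b} I) := by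
  rcases h with h | h
  · exact ⟨{r}, hr.isInfo, S.arrow_trans _ _ _ h (hr.rev_comb (S.singleton_mem b)).1⟩
  · exact (hdemon b a {r} hr.isInfo
      (S.arrow_trans _ _ _ h (hr.rev_comb (S.singleton_mem a)).1)).1

/-- Combining two possible singleton processes gives a possible process. -/
theorem Pos.pair (hdemon : S.DemonAxiom) {r : S.State} (hr : S.IsRecord r)
    {a b c d : S.State} (h : S.Pos {a} {b}) (h' : S.Pos {c} {d}) :
    S.Pos {S.pair a c} {S.pair b d} := by
  obtain ⟨I, hI, hab⟩ := h.exists_info hdemon hr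
  obtain ⟨J, hJ, hcd⟩ := h'.exists_info hdemon hr
  have hb := S.singleton_mem b
  have hd := S.singleton_mem d
  have hc := S.singleton_mem c
  have hbI := comb_mem_eido hb hI.1
  have hdJ := comb_mem_eido hd hJ.1
  have key : S.Arrow {S.pair a c} (S.comb {S.pair b d} (S.comb I J)) := by
    rw [← comb_singleton, ← comb_singleton]
    exact S.arrow_trans _ _ _ (S.arrow_comb _ _ {c} hab) <|
      S.arrow_trans _ _ _ (arrow_comb_left hc hdJ hbI hcd) (arrow_comb_comb_comm hb hI.1 hd hJ.1)
  have hrev := hr.rev_comb (S.singleton_mem (S.pair b d))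
  rcases (hdemon _ _ _ (hI.comb hJ) key).2 {r} hr.isInfo with h1 | h1
  · exact Or.inl (S.arrow_trans _ _ _ h1 hrev.2)
  · exact Or.inr (S.arrow_trans _ _ _ hrev.1 h1)

theorem uniform_singleton (a : S.State) : S.Uniform {a} := by
  refine ⟨S.singleton_mem a, fun b hb c hc => ?_⟩
  rw [Finset.mem_singleton.1 hb, Finset.mem_singleton.1 hc]
  exact Or.inl (arrow_refl (S.singleton_mem a))

theorem Uniform.comb (hdemon : S.DemonAxiom) {r : S.State} (hr : S.IsRecord r)
    {E F : Finset S.State} (hE : S.Uniform E) (hF : S.Uniform F) : S.Uniform (S.comb E F) := by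
  refine ⟨comb_mem_eido hE.1 hF.1, fun s hs t ht => ?_⟩
  obtain ⟨a, ha, c, hc, rfl⟩ := Finset.mem_image₂.1 hs
  obtain ⟨b, hb, d, hd, rfl⟩ := Finset.mem_image₂.1 ht
  exact (hE.2 a ha b hb).pair hdemon hr (hF.2 c hc d hd)

/-- Uniform eidostates can be cancelled, as each is equivalent to a difference of states. -/
theorem arrow_of_arrow_comb_uniform (hse : S.StateEquivAxiom) {A B C : Finset S.State}
    (hA : A ∈ S.Eido) (hB : B ∈ S.Eido) (hC : S.Uniform C)
    (h : S.Arrow (S.comb A C) (S.comb B C)) : S.Arrow A B := by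
  obtain ⟨e, x, y, -, hC1, hC2⟩ := hse C hC
  have hx := S.singleton_mem x
  have hCx := comb_mem_eido hC.1 hx
  have hey := comb_mem_eido (S.singleton_mem e) (S.singleton_mem y)
  have h1 : S.Arrow (S.comb A (S.comb {e} {y})) (S.comb B (S.comb {e} {y})) :=
    S.arrow_trans _ _ _ (arrow_comb_left hey hCx hA hC2) <|
      S.arrow_trans _ _ _ (arrow_assoc_symm hA hC.1 hx) <|
      S.arrow_trans _ _ _ (S.arrow_comb _ _ {x} h) <|
      S.arrow_trans _ _ _ (arrow_assoc hB hC.1 hx) (arrow_comb_left hCx hey hB hC1)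
  rw [comb_singleton] at h1
  exact S.arrow_cancel _ _ _ h1

theorem copies_singleton (a : S.State) (n : ℕ) : ∃ c, S.copies {a} n = {c} := by
  induction n with
  | zero => exact ⟨a, rfl⟩
  | succ n ih =>
    obtain ⟨c, hc⟩ := ih
    exact ⟨S.pair a c, by rw [copies, hc, comb_singleton]⟩

theorem Uniform.copies (hdemon : S.DemonAxiom) {r : S.State} (hr : S.IsRecord r)
    {E : Finset S.State} (hE : S.Uniform E) (n : ℕ) : S.Uniform (S.copies E n) := by
  induction n with
  | zero => exact hE
  | succ n ih => exact hE.comb hdemon hr ih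

/-- The uniform eidostates, up to reversible equivalence, embed into a partially ordered abelian
group whose elements are all differences of states. -/
theorem exists_uniform_embedding (hdemon : S.DemonAxiom) (hse : S.StateEquivAxiom) {r : S.State}
    (hr : S.IsRecord r) :
    ∃ (G : Type) (_ : AddCommGroup G) (_ : PartialOrder G) (_ : IsOrderedAddMonoid G)
      (φ : Finset S.State → G),
      (∀ E F, S.Uniform E → S.Uniform F → φ (S.comb E F) = φ E + φ F) ∧
      (∀ E F, S.Uniform E → S.Uniform F → (φ E ≤ φ F ↔ S.Arrow E F)) ∧
      ∀ g, ∃ a b : S.State, g = φ {a} - φ {b} := by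
  classical
  let U := {E : Finset S.State // S.Uniform E}
  let : Preorder U :=
    { le := fun E F => S.Arrow E.1 F.1
      lt := fun E F => S.Arrow E.1 F.1 ∧ ¬ S.Arrow F.1 E.1
      le_refl := fun E => arrow_refl E.2.1
      le_trans := fun E F K => S.arrow_trans E.1 F.1 K.1 }
  obtain ⟨G, i₁, i₂, i₃, ψ, ψ_add, ψ_le, ψ_sub⟩ :=
    exists_ordered_difference_group (α := U)
      (fun E F => ⟨S.comb E.1 F.1, E.2.comb hdemon hr F.2⟩) ⟨{r}, uniform_singleton r⟩
      (fun E F => arrow_comm E.2.1 F.2.1) (fun E F K => arrow_assoc E.2.1 F.2.1 K.2.1)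
      (fun E F K h => S.arrow_comb E.1 F.1 K.1 h)
      (fun E F K h => arrow_of_arrow_comb_uniform hse E.2.1 F.2.1 K.2 h)
      (fun E => (hr.rev_comb E.2.1).2) (fun E => (hr.rev_comb E.2.1).1)
  let φ : Finset S.State → G := fun E => if h : S.Uniform E then ψ ⟨E, h⟩ else 0
  have φ_eq {E : Finset S.State} (h : S.Uniform E) : φ E = ψ ⟨E, h⟩ := dif_pos h
  have φ_add (E F : Finset S.State) (hE : S.Uniform E) (hF : S.Uniform F) :
      φ (S.comb E F) = φ E + φ F := by
    rw [φ_eq (hE.comb hdemon hr hF), φ_eq hE, φ_eq hF]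
    exact ψ_add ⟨E, hE⟩ ⟨F, hF⟩
  have φ_le (E F : Finset S.State) (hE : S.Uniform E) (hF : S.Uniform F) :
      φ E ≤ φ F ↔ S.Arrow E F := by
    rw [φ_eq hE, φ_eq hF]
    exact ψ_le ⟨E, hE⟩ ⟨F, hF⟩
  have φ_pair (a b : S.State) : φ {S.pair a b} = φ {a} + φ {b} := by
    rw [← comb_singleton, φ_add _ _ (uniform_singleton a) (uniform_singleton b)]
  have φ_state (E : Finset S.State) (hE : S.Uniform E) : ∃ a b : S.State, φ E = φ {a} - φ {b} := by
    obtain ⟨e, x, y, -, h, h'⟩ := hse E hE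
    have hx := hE.comb hdemon hr (uniform_singleton x)
    have hy := (uniform_singleton e).comb hdemon hr (uniform_singleton y)
    have key := le_antisymm ((φ_le _ _ hx hy).2 h) ((φ_le _ _ hy hx).2 h')
    rw [φ_add _ _ hE (uniform_singleton x), comb_singleton] at key
    exact ⟨S.pair e y, x, eq_sub_of_add_eq key⟩
  refine ⟨G, i₁, i₂, i₃, φ, φ_add, φ_le, fun g => ?_⟩
  obtain ⟨⟨E, hE⟩, ⟨F, hF⟩, rfl⟩ := ψ_sub g
  rw [← φ_eq hE, ← φ_eq hF]
  obtain ⟨a, b, hab⟩ := φ_state E hE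
  obtain ⟨c, d, hcd⟩ := φ_state F hF
  refine ⟨S.pair a d, S.pair b c, ?_⟩
  rw [hab, hcd, φ_pair, φ_pair]
  abel

end EidoSys

/-- Uniform eidostate thermodynamics: there exist an entropy function 𝕊 and a
set 𝒬 of components of content on the uniform eidostates 𝒰 with: (a) 𝕊 additive; (b) every
Q ∈ 𝒬 additive; (c) for E, F ∈ 𝒰, E → F iff 𝕊(E) ≤ 𝕊(F) and Q(E) = Q(F) for all Q ∈ 𝒬;
(d) 𝕊(m) = 0 for every mechanical state m. -/
theorem stmt12 (S : EidoSys) (hinfo : S.InfoAxiom) (hdemon : S.DemonAxiom)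
    (hstab : S.StabilityAxiom) (hse : S.StateEquivAxiom)
    (M : Set S.State) (hM : S.MechSet M) :
    ∃ (Ent : Finset S.State → ℝ) (Qs : Set (Finset S.State → ℝ)),
      (∀ Q ∈ Qs, S.IsCoCU Q) ∧
      (∀ E F : Finset S.State, S.Uniform E → S.Uniform F →
        Ent (S.comb E F) = Ent E + Ent F) ∧
      (∀ Q ∈ Qs, ∀ E F : Finset S.State, S.Uniform E → S.Uniform F →
        Q (S.comb E F) = Q E + Q F) ∧
      (∀ E F : Finset S.State, S.Uniform E → S.Uniform F →
        (S.Arrow E F ↔ (Ent E ≤ Ent F ∧ ∀ Q ∈ Qs, Q E = Q F))) ∧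
      (∀ m ∈ M, Ent {m} = 0) := by
  classical
  obtain ⟨r, -, hr, -, -⟩ := hinfo
  obtain ⟨G, _, _, _, φ, φ_add, φ_le, φ_sub⟩ := S.exists_uniform_embedding hdemon hse hr
  have hU := fun a : S.State => EidoSys.uniform_singleton a
  have φ_pair (a b : S.State) : φ {S.pair a b} = φ {a} + φ {b} := by
    rw [← EidoSys.comb_singleton, φ_add _ _ (hU a) (hU b)]
  have φ_copies (E : Finset S.State) (hE : S.Uniform E) (n : ℕ) :
      φ (S.copies E n) = (n + 1) • φ E := by
    induction n with
    | zero => rw [zero_add, one_smul]; rfl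
    | succ n ih =>
      rw [EidoSys.copies, φ_add _ _ hE (hE.copies hdemon hr n), ih, add_smul (n + 1) 1, one_smul,
        add_comm]
  have stab (a b : S.State) (J : Finset S.State) (hJ : S.IsInfo J)
      (h : ∀ N : ℕ, ∃ n ≥ N, (n + 1) • (φ {a} - φ {b}) ≤ φ J) : φ {a} ≤ φ {b} := by
    rw [φ_le _ _ (hU a) (hU b)]
    refine hstab _ _ J (hU a).1 (hU b).1 hJ fun N => ?_
    obtain ⟨n, hn, h⟩ := h N
    have hb := (hU b).copies hdemon hr n
    refine ⟨n, hn, ?_⟩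
    rw [← φ_le _ _ ((hU a).copies hdemon hr n) (hb.comb hdemon hr hJ.uniform),
      φ_add _ _ hb hJ.uniform, φ_copies _ (hU a), φ_copies _ (hU b)]
    rwa [smul_sub, sub_le_iff_le_add'] at h
  have φ_record : φ {r} = 0 := by
    have hrev := hr.rev_comb (hU r).1
    have hrr := (hU r).comb hdemon hr (hU r)
    have key := le_antisymm ((φ_le _ _ (hU r) hrr).2 hrev.1) ((φ_le _ _ hrr (hU r)).2 hrev.2)
    rwa [φ_add _ _ (hU r) (hU r), left_eq_add] at key
  have comparable_iff (E F : Finset S.State) (hE : S.Uniform E) (hF : S.Uniform F) :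
      (0 ≤ φ E - φ F ∨ φ E - φ F ≤ 0) ↔ S.Pos E F := by
    rw [sub_nonneg, sub_nonpos, φ_le _ _ hE hF, φ_le _ _ hF hE, or_comm]
    rfl
  let H : AddSubgroup G :=
    { carrier := {g | 0 ≤ g ∨ g ≤ 0}
      zero_mem' := Or.inl le_rfl
      neg_mem' := fun {g} hg => by
        simpa [or_comm] using hg
      add_mem' := fun {g g'} hg hg' => by
        obtain ⟨a, b, rfl⟩ := φ_sub g
        obtain ⟨c, d, rfl⟩ := φ_sub g'
        simp only [Set.mem_ofPred_eq] at hg hg' ⊢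
        rw [comparable_iff _ _ (hU _) (hU _)] at hg hg'
        rw [sub_add_sub_comm, ← φ_pair, ← φ_pair, comparable_iff _ _ (hU _) (hU _)]
        exact hg.pair hdemon hr hg' }
  have mem_H (g : G) : g ∈ H ↔ 0 ≤ g ∨ g ≤ 0 := Iff.rfl
  let N : AddSubgroup G :=
    { carrier := {g | g = 0 ∨ ∃ l ∈ M, ∃ m ∈ M, g = φ {l} - φ {m}}
      zero_mem' := Or.inl rfl
      neg_mem' := by
        rintro _ (rfl | ⟨l, hl, m, hm, rfl⟩)
        · exact Or.inl neg_zero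
        · exact Or.inr ⟨m, hm, l, hl, neg_sub _ _⟩
      add_mem' := by
        rintro _ _ (rfl | ⟨l, hl, m, hm, rfl⟩) (rfl | ⟨l', hl', m', hm', rfl⟩)
        · exact Or.inl (add_zero 0)
        · exact Or.inr ⟨l', hl', m', hm', zero_add _⟩
        · exact Or.inr ⟨l, hl, m, hm, add_zero _⟩
        · refine Or.inr ⟨_, hM.1 l hl l' hl', _, hM.1 m hm m' hm', ?_⟩
          rw [φ_pair, φ_pair, sub_add_sub_comm] }
  have hN (g : G) (hg : g ∈ N) (hgH : g ∈ H) : g = 0 := by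
    obtain rfl | ⟨l, hl, m, hm, rfl⟩ := hg
    · rfl
    · rw [mem_H, comparable_iff _ _ (hU _) (hU _)] at hgH
      have h : S.Arrow {l} {m} ∧ S.Arrow {m} {l} :=
        hgH.elim (fun h => ⟨h, hM.2 l hl m hm h⟩) fun h => ⟨hM.2 m hm l hl h, h⟩
      rw [← φ_le _ _ (hU l) (hU m), ← φ_le _ _ (hU m) (hU l)] at h
      exact sub_eq_zero.2 (le_antisymm h.1 h.2)
  have harch (x y : G) (hy : 0 ≤ y) (hxy : ∀ n : ℕ, n • x ≤ y) : x ≤ 0 := by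
    obtain ⟨a, b, rfl⟩ := φ_sub x
    obtain ⟨c, d, rfl⟩ := φ_sub y
    have hpos := (comparable_iff _ _ (hU c) (hU d)).1 (Or.inl hy)
    obtain ⟨J, hJ, hcd⟩ := hpos.exists_info hdemon hr
    rw [← φ_le _ _ (hU c) ((hU d).comb hdemon hr hJ.uniform), φ_add _ _ (hU d) hJ.uniform,
      ← sub_le_iff_le_add'] at hcd
    exact sub_nonpos.2 (stab a b J hJ fun n => ⟨n, le_rfl, (hxy (n + 1)).trans hcd⟩)
  have nonpos_of_smul (n : ℕ) (x : G) (hn : n ≠ 0) (h : n • x ≤ 0) : x ≤ 0 := by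
    obtain ⟨a, b, rfl⟩ := φ_sub x
    refine sub_nonpos.2 (stab a b {r} hr.isInfo fun k => ⟨n * (k + 1) - 1, ?_, ?_⟩)
    · have := Nat.le_mul_of_pos_left (k + 1) (Nat.pos_of_ne_zero hn)
      omega
    · rw [Nat.sub_add_cancel (Nat.mul_pos (Nat.pos_of_ne_zero hn) k.succ_pos), mul_comm, mul_smul,
        φ_record]
      exact nsmul_nonpos h _
  have htors (n : ℕ) (x : G) (hn : n ≠ 0) (h : n • x ∈ H) : x ∈ H := by
    rcases h with h | h
    · refine Or.inl (neg_nonpos.1 (nonpos_of_smul n (-x) hn ?_))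
      rwa [smul_neg, neg_nonpos]
    · exact Or.inr (nonpos_of_smul n x hn h)
  obtain ⟨s, hsN, hsH⟩ := exists_real_hom_order_iff H N mem_H (fun x y _ => harch x y) hN
  refine ⟨fun E => s (φ E), {Q | ∃ q : G →+ ℝ, (∀ h ∈ H, q h = 0) ∧ Q = fun E => q (φ E)},
    ?_, fun E F hE hF => ?_, ?_, fun E F hE hF => ⟨fun h => ⟨?_, ?_⟩, fun ⟨h, hQ⟩ => ?_⟩,
    fun m hm => ?_⟩
  · rintro _ ⟨q, hq, rfl⟩
    refine ⟨fun E F hE hF => ?_, fun E F hE hF h => ?_⟩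
    · simp only [φ_add _ _ hE hF, map_add]
    · have := hq _ ((comparable_iff _ _ hE hF).2 h)
      rwa [map_sub, sub_eq_zero] at this
  · simp only [φ_add _ _ hE hF, map_add]
  · rintro _ ⟨q, hq, rfl⟩ E F hE hF
    simp only [φ_add _ _ hE hF, map_add]
  · have h0 : 0 ≤ φ F - φ E := sub_nonneg.2 ((φ_le _ _ hE hF).2 h)
    have := (hsH _ (Or.inl h0)).1 h0
    rwa [map_sub, sub_nonneg] at this
  · rintro _ ⟨q, hq, rfl⟩
    have := hq _ ((comparable_iff _ _ hE hF).2 (Or.inl h))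
    rwa [map_sub, sub_eq_zero] at this
  · have hmem : φ F - φ E ∈ H := mem_of_forall_real_hom_eq_zero H htors _ fun q hq => by
      rw [map_sub, sub_eq_zero]
      exact (hQ _ ⟨q, hq, rfl⟩).symm
    rw [← φ_le _ _ hE hF, ← sub_nonneg, hsH _ hmem, map_sub, sub_nonneg]
    exact h
  · refine hsN _ (Or.inr ⟨S.pair m m, hM.1 m hm m hm, m, hm, ?_⟩)
    rw [φ_pair, add_sub_cancel_right]
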